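/- arXiv:2210.10980 — 4 statements merged into one kernel-verified Lean document; each statement's English description precedes it below -/
import Mathlib

section
/- The number of primes up to x satisfies the asymptotic |{n : p_n ≤ x}| = (1 + o(1)) · x / log x as x → ∞; equivalently, π(x) · log x / x tends to 1 as x → ∞, where π(x) denotes the number of primes not exceeding x. -/
open Filter

/-- The Fejér kernel. -/
noncomputable def fejerKernel (x : ℝ) : ℝ := ∫ t in (0 : ℝ)..1, 2 * (1 - t) * Real.cos (x * t)

lemma continuous_fejerKernel : Continuous fejerKernel := by
  unfold fejerKernel
  refine intervalIntegral.continuous_parametric_intervalIntegral_of_continuous' ?_ 0 1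
  simp only [Function.uncurry_def]
  fun_prop

lemma fejerKernel_eq {x : ℝ} (hx : x ≠ 0) :
    fejerKernel x = 2 * (1 - Real.cos x) / x ^ 2 := by
  have h : ∀ t ∈ Set.uIcc (0 : ℝ) 1,
      HasDerivAt (fun t ↦ 2 * ((1 - t) * Real.sin (x * t) / x - Real.cos (x * t) / x ^ 2))
        (2 * (1 - t) * Real.cos (x * t)) t := by
    intro t _
    have hx1 : HasDerivAt (fun t : ℝ ↦ x * t) x t := by
      simpa using (hasDerivAt_id t).const_mul x
    have h1 := (((hasDerivAt_id t).const_sub 1).mul hx1.sin).div_const x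
    have h2 := hx1.cos.div_const (x ^ 2)
    refine ((h1.sub h2).const_mul 2).congr_deriv ?_
    simp only [id]
    field_simp
    ring
  rw [fejerKernel, intervalIntegral.integral_eq_sub_of_hasDerivAt h
    (Continuous.intervalIntegrable (by fun_prop) _ _)]
  simp
  field_simp
  ring

lemma fejerKernel_zero : fejerKernel 0 = 1 := by
  have h : ∀ t ∈ Set.uIcc (0 : ℝ) 1, HasDerivAt (fun t ↦ 2 * t - t ^ 2) (2 * (1 - t)) t := by
    intro t _
    refine (((hasDerivAt_id t).const_mul 2).sub (hasDerivAt_pow 2 t)).congr_deriv ?_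
    norm_num
    ring
  simp only [fejerKernel, zero_mul, Real.cos_zero, mul_one]
  rw [intervalIntegral.integral_eq_sub_of_hasDerivAt h
    (Continuous.intervalIntegrable (by fun_prop) _ _)]
  norm_num

lemma fejerKernel_nonneg (x : ℝ) : 0 ≤ fejerKernel x := by
  rcases eq_or_ne x 0 with rfl | hx
  · simp [fejerKernel_zero]
  · rw [fejerKernel_eq hx]
    have := Real.cos_le_one x
    have : 0 ≤ 1 - Real.cos x := by linarith
    positivity

lemma fejerKernel_le (x : ℝ) : fejerKernel x ≤ 5 * (1 + x ^ 2)⁻¹ := by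
  rw [← div_eq_mul_inv, le_div_iff₀ (by positivity)]
  rcases eq_or_ne x 0 with rfl | hx
  · simp [fejerKernel_zero]
  · have h1 := Real.neg_one_le_cos x
    have h2 := Real.one_sub_sq_div_two_le_cos (x := x)
    rw [fejerKernel_eq hx, div_mul_eq_mul_div, div_le_iff₀ (by positivity)]
    nlinarith [sq_nonneg x]

lemma integrable_fejerKernel : MeasureTheory.Integrable fejerKernel := by
  refine (integrable_inv_one_add_sq.const_mul 5).mono'
    continuous_fejerKernel.aestronglyMeasurable (MeasureTheory.ae_of_all _ fun x ↦ ?_)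
  rw [Real.norm_of_nonneg (fejerKernel_nonneg x)]
  exact fejerKernel_le x

lemma integral_fejerKernel_pos : 0 < ∫ x, fejerKernel x := by
  rw [MeasureTheory.integral_pos_iff_support_of_nonneg fejerKernel_nonneg integrable_fejerKernel]
  refine continuous_fejerKernel.isOpen_support.measure_pos _ ⟨0, ?_⟩
  simp [fejerKernel_zero]

open MeasureTheory Complex in
/-- Exponentially damped Fejér averages as Fourier integrals of the Laplace transform. -/
lemma integral_mul_exp_mul_fejerKernel {g : ℝ → ℝ} {C : ℝ} (hg : Measurable g)
    (hgC : ∀ u, |g u| ≤ C) {ε : ℝ} (hε : 0 < ε) (r y : ℝ) :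
    ∫ u in Set.Ioi (0 : ℝ), g u * Real.exp (-ε * u) * fejerKernel (r * (u - y)) =
      (∫ t in (0 : ℝ)..1, (2 * (1 - t) : ℝ) * cexp (r * y * t * I) *
        ∫ u in Set.Ioi (0 : ℝ), (g u : ℂ) * cexp (-(ε + r * t * I) * u)).re := by
  set F : ℝ → ℝ → ℂ := fun t u ↦ (2 * (1 - t) : ℝ) * cexp (r * y * t * I) *
    ((g u : ℂ) * cexp (-(ε + r * t * I) * u)) with hF
  have hnorm (a : ℝ) : ‖cexp (a * I)‖ = 1 := norm_exp_ofReal_mul_I a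
  have hFint : Integrable (Function.uncurry F)
      ((volume.restrict (Set.uIoc 0 1)).prod (volume.restrict (Set.Ioi 0))) := by
    have h1 : Integrable (fun t : ℝ ↦ |2 * (1 - t)|) (volume.restrict (Set.uIoc 0 1)) := by
      rw [← IntegrableOn, ← intervalIntegrable_iff]
      exact Continuous.intervalIntegrable (by fun_prop) _ _
    have h2 : Integrable (fun u : ℝ ↦ C * Real.exp (-ε * u)) (volume.restrict (Set.Ioi 0)) :=
      (integrableOn_exp_mul_Ioi (by linarith) 0).const_mul C
    refine (h1.mul_prod h2).mono' ?_ (ae_of_all _ fun ⟨t, u⟩ ↦ ?_)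
    · refine Measurable.aestronglyMeasurable ?_
      simp only [hF, Function.uncurry_def]
      fun_prop
    · have e1 : cexp (r * y * t * I) = cexp ((r * y * t : ℝ) * I) := by push_cast; rfl
      have e2 : cexp (-(ε + r * t * I) * u) =
          (Real.exp (-ε * u) : ℂ) * cexp ((-r * t * u : ℝ) * I) := by
        push_cast
        rw [← Complex.exp_add]
        congr 1
        ring
      simp only [hF, Function.uncurry_apply_pair, norm_mul, e1, e2, hnorm, Complex.norm_real,
        Real.norm_eq_abs, mul_one, Real.abs_exp]
      rw [abs_mul]
      gcongr
      exact hgC u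
  have hre (t u : ℝ) : (F t u).re = g u * Real.exp (-ε * u) *
      (2 * (1 - t) * Real.cos (r * (u - y) * t)) := by
    have e : F t u = ((2 * (1 - t) * g u * Real.exp (-ε * u) : ℝ) : ℂ) *
        cexp ((-(r * (u - y) * t) : ℝ) * I) := by
      simp only [hF]
      push_cast
      rw [mul_assoc _ (cexp (-ε * u)), ← Complex.exp_add, mul_mul_mul_comm, ← Complex.exp_add]
      congr 2
      ring
    rw [e, Complex.re_ofReal_mul, Complex.exp_ofReal_mul_I_re, Real.cos_neg]
    ring
  have hinner (u : ℝ) : (∫ t in (0 : ℝ)..1, F t u).re =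
      g u * Real.exp (-ε * u) * fejerKernel (r * (u - y)) := by
    have hi : IntervalIntegrable (fun t ↦ F t u) volume 0 1 := by
      refine Continuous.intervalIntegrable ?_ _ _
      simp only [hF]
      fun_prop
    rw [← reCLM_apply, ← reCLM.intervalIntegral_comp_comm hi, fejerKernel,
      ← intervalIntegral.integral_const_mul]
    simp only [reCLM_apply, hre]
  have hswap := intervalIntegral_integral_swap hFint
  have hL : ∫ t in (0 : ℝ)..1, (2 * (1 - t) : ℝ) * cexp (r * y * t * I) *
      ∫ u in Set.Ioi (0 : ℝ), (g u : ℂ) * cexp (-(ε + r * t * I) * u) =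
      ∫ t in (0 : ℝ)..1, ∫ u in Set.Ioi (0 : ℝ), F t u := by
    simp only [hF, integral_const_mul]
  have hint : Integrable (fun u ↦ ∫ t in (0 : ℝ)..1, F t u) (volume.restrict (Set.Ioi 0)) := by
    have := hFint.integral_prod_right
    rw [Set.uIoc_of_le zero_le_one] at this
    simpa only [intervalIntegral.integral_of_le zero_le_one, Function.uncurry_apply_pair] using this
  rw [hL, hswap, ← reCLM_apply, ← reCLM.integral_comp_comm hint]
  simp only [reCLM_apply, hinner]

open MeasureTheory Complex Topology in
/-- The Fejér averages of a bounded function are the Fourier integrals of the boundary values of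
its Laplace transform, if these exist. -/
lemma integral_mul_fejerKernel {g : ℝ → ℝ} {C : ℝ} (hg : Measurable g) (hgC : ∀ u, |g u| ≤ C)
    {G : ℂ → ℂ} (hG : ContinuousOn G {s | 0 ≤ s.re})
    (hgG : ∀ s : ℂ, 0 < s.re → ∫ u in Set.Ioi (0 : ℝ), (g u : ℂ) * cexp (-s * u) = G s)
    {r : ℝ} (hr : 0 < r) (y : ℝ) :
    ∫ u in Set.Ioi (0 : ℝ), g u * fejerKernel (r * (u - y)) =
      (∫ t in (0 : ℝ)..1, (2 * (1 - t) : ℝ) * cexp (r * y * t * I) * G (r * t * I)).re := by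
  have hKi : Integrable fun u ↦ fejerKernel (r * (u - y)) :=
    (integrable_fejerKernel.comp_mul_left' hr.ne').comp_sub_right y
  have hleft : Tendsto (fun ε : ℝ ↦ ∫ u in Set.Ioi (0 : ℝ),
      g u * Real.exp (-ε * u) * fejerKernel (r * (u - y))) (𝓝[>] 0)
      (𝓝 (∫ u in Set.Ioi (0 : ℝ), g u * fejerKernel (r * (u - y)))) := by
    refine tendsto_integral_filter_of_dominated_convergence
      (fun u ↦ C * fejerKernel (r * (u - y))) (Eventually.of_forall fun ε ↦ ?_) ?_
      (hKi.integrableOn.const_mul C) (ae_of_all _ fun u ↦ ?_)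
    · have := continuous_fejerKernel.measurable
      exact Measurable.aestronglyMeasurable (by fun_prop)
    · filter_upwards [self_mem_nhdsWithin] with ε (hε : 0 < ε)
      refine (ae_restrict_iff' measurableSet_Ioi).2 (ae_of_all _ fun u (hu : 0 < u) ↦ ?_)
      have he : Real.exp (-ε * u) ≤ 1 := by
        rw [Real.exp_le_one_iff, neg_mul, neg_nonpos]
        positivity
      rw [norm_mul, norm_mul, Real.norm_of_nonneg (fejerKernel_nonneg _),
        Real.norm_of_nonneg (Real.exp_pos _).le, Real.norm_eq_abs]
      refine mul_le_mul_of_nonneg_right ?_ (fejerKernel_nonneg _)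
      exact (mul_le_of_le_one_right (abs_nonneg _) he).trans (hgC u)
    · have : Continuous fun ε : ℝ ↦ g u * Real.exp (-ε * u) * fejerKernel (r * (u - y)) := by
        fun_prop
      simpa using this.continuousAt.tendsto.mono_left (nhdsWithin_le_nhds (a := (0 : ℝ)))
  have hmaps : Set.MapsTo (fun p : ℝ × ℝ ↦ (p.1 + r * p.2 * I : ℂ))
      (Set.Icc 0 1 ×ˢ Set.Icc 0 1) {s | 0 ≤ s.re} := fun p hp ↦ by
    simpa using hp.1.1
  have hcont : ContinuousOn (fun p : ℝ × ℝ ↦ (2 * (1 - p.2) : ℝ) * cexp (r * y * p.2 * I) *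
      G (p.1 + r * p.2 * I)) (Set.Icc 0 1 ×ˢ Set.Icc 0 1) :=
    ContinuousOn.mul (Continuous.continuousOn (by fun_prop))
      (hG.comp (Continuous.continuousOn (by fun_prop)) hmaps)
  obtain ⟨M, hM⟩ := (isCompact_Icc.prod isCompact_Icc).exists_bound_of_continuousOn hcont
  have hsmall : ∀ᶠ ε : ℝ in 𝓝[>] 0, ε ∈ Set.Icc (0 : ℝ) 1 := by
    filter_upwards [Ioo_mem_nhdsGT (zero_lt_one (α := ℝ))] with ε hε using ⟨hε.1.le, hε.2.le⟩
  have hright : Tendsto (fun ε : ℝ ↦ ∫ t in (0 : ℝ)..1, (2 * (1 - t) : ℝ) *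
      cexp (r * y * t * I) * G (ε + r * t * I)) (𝓝[>] 0)
      (𝓝 (∫ t in (0 : ℝ)..1, (2 * (1 - t) : ℝ) * cexp (r * y * t * I) * G (r * t * I))) := by
    have hIoc {t : ℝ} (ht : t ∈ Set.uIoc (0 : ℝ) 1) : t ∈ Set.Icc (0 : ℝ) 1 := by
      rw [Set.uIoc_of_le zero_le_one] at ht
      exact Set.Ioc_subset_Icc_self ht
    refine intervalIntegral.tendsto_integral_filter_of_dominated_convergence (fun _ ↦ M)
      ?_ ?_ intervalIntegrable_const (ae_of_all _ fun t ht ↦ ?_)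
    · filter_upwards [hsmall] with ε hε
      refine ContinuousOn.aestronglyMeasurable ?_ measurableSet_uIoc
      exact hcont.comp (f := fun t : ℝ ↦ (ε, t)) (by fun_prop) fun t ht ↦ ⟨hε, hIoc ht⟩
    · filter_upwards [hsmall] with ε hε
      exact ae_of_all _ fun t ht ↦ hM (ε, t) ⟨hε, hIoc ht⟩
    · have h0 := hcont (0, t) ⟨by simp, hIoc ht⟩
      have h1 : Tendsto (fun ε : ℝ ↦ (ε, t)) (𝓝[>] 0)
          (𝓝[Set.Icc 0 1 ×ˢ Set.Icc 0 1] (0, t)) :=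
        tendsto_nhdsWithin_iff.2 ⟨(Continuous.tendsto (by fun_prop) 0).mono_left
          nhdsWithin_le_nhds, by filter_upwards [hsmall] with ε hε using ⟨hε, hIoc ht⟩⟩
      simpa [Function.comp_def] using Tendsto.comp h0 h1
  refine tendsto_nhds_unique hleft (((continuous_re.tendsto _).comp hright).congr' ?_)
  filter_upwards [self_mem_nhdsWithin] with ε (hε : 0 < ε)
  rw [integral_mul_exp_mul_fejerKernel hg hgC hε, Function.comp_apply]
  congr 2
  ext t
  rw [hgG _ (by simpa using hε)]

open MeasureTheory Complex Topology in
/-- The Fejér averages of a bounded function whose Laplace transform extends continuously to the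
closed right half-plane tend to zero. -/
lemma tendsto_integral_mul_fejerKernel {g : ℝ → ℝ} {C : ℝ} (hg : Measurable g)
    (hgC : ∀ u, |g u| ≤ C) {G : ℂ → ℂ} (hG : ContinuousOn G {s | 0 ≤ s.re})
    (hgG : ∀ s : ℂ, 0 < s.re → ∫ u in Set.Ioi (0 : ℝ), (g u : ℂ) * cexp (-s * u) = G s)
    {r : ℝ} (hr : 0 < r) :
    Tendsto (fun y ↦ ∫ u in Set.Ioi (0 : ℝ), g u * fejerKernel (r * (u - y))) atTop (𝓝 0) := by
  simp only [integral_mul_fejerKernel hg hgC hG hgG hr]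
  have hRL := Real.tendsto_integral_exp_smul_cocompact
    ((Set.Ioc (0 : ℝ) 1).indicator fun t ↦ (2 * (1 - t) : ℝ) * G (r * t * I))
  have hw : Tendsto (fun y : ℝ ↦ -(r / (2 * Real.pi)) * y) atTop (cocompact ℝ) :=
    (tendsto_id.const_mul_atTop_of_neg (neg_neg_of_pos (by positivity))).mono_right
      atBot_le_cocompact
  have := (continuous_re.tendsto _).comp (hRL.comp hw)
  rw [zero_re] at this
  refine this.congr fun y ↦ ?_
  simp only [Function.comp_apply]
  rw [intervalIntegral.integral_of_le zero_le_one, ← integral_indicator measurableSet_Ioc]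
  congr 2
  ext t
  by_cases ht : t ∈ Set.Ioc (0 : ℝ) 1
  · simp only [Set.indicator_of_mem ht, Circle.smul_def, Real.fourierChar_apply, smul_eq_mul]
    rw [mul_left_comm, ← mul_assoc]
    congr 3
    push_cast
    have := ofReal_ne_zero.2 Real.pi_ne_zero
    field_simp
  · simp [Set.indicator_of_notMem ht]

lemma measurable_of_monotone_mul_exp {f : ℝ → ℝ} (hf : Monotone fun u ↦ f u * Real.exp u) :
    Measurable f := by
  convert hf.measurable.mul (Real.measurable_exp.comp measurable_neg) using 1
  ext u
  simp [mul_assoc, ← Real.exp_add]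

open MeasureTheory Topology in
/-- If `f` is bounded, `f u * exp u` is monotone, and all rescaled averages of `f` against a
nonnegative kernel converge to the mass of the kernel, then `f` converges to `1`. -/
lemma tendsto_one_of_tendsto_average {f K : ℝ → ℝ} {B : ℝ} (hf0 : ∀ u, 0 ≤ f u)
    (hfB : ∀ u, f u ≤ B) (hmono : Monotone fun u ↦ f u * Real.exp u) (hK : ∀ v, 0 ≤ K v)
    (hKi : Integrable K) (hpos : 0 < ∫ v, K v)
    (h : ∀ r > 0, Tendsto (fun y ↦ ∫ v, f (y + v / r) * K v) atTop (𝓝 (∫ v, K v))) :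
    Tendsto f atTop (𝓝 1) := by
  set c := ∫ v, K v with hc
  set I : ℝ → ℝ := fun R ↦ ∫ v in Set.Icc (-R) R, K v with hI
  have hIc : Tendsto I atTop (𝓝 c) :=
    (aecover_Icc tendsto_neg_atTop_atBot tendsto_id).integral_tendsto_of_countably_generated hKi
  have hfm : Measurable f := measurable_of_monotone_mul_exp hmono
  have hint (y r : ℝ) : Integrable fun v ↦ f (y + v / r) * K v := by
    refine hKi.bdd_mul (c := B) (hfm.comp (by fun_prop)).aestronglyMeasurable
      (ae_of_all _ fun v ↦ ?_)
    rw [Real.norm_of_nonneg (hf0 _)]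
    exact hfB _
  have hle {y z d : ℝ} (hyz : y ≤ z) (hzd : z ≤ y + d) : f y ≤ f z * Real.exp d := by
    have h1 := hmono hyz
    have h2 : f z * Real.exp z ≤ f z * Real.exp (y + d) :=
      mul_le_mul_of_nonneg_left (Real.exp_le_exp.2 hzd) (hf0 z)
    have h3 := h1.trans h2
    rw [Real.exp_add, mul_comm (Real.exp y), ← mul_assoc] at h3
    exact le_of_mul_le_mul_right h3 (Real.exp_pos y)
  have habs {R v : ℝ} (hR : 0 < R) (hv : v ∈ Set.Icc (-R) R) :
      -(1 / R) ≤ v / R ^ 2 ∧ v / R ^ 2 ≤ 1 / R := by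
    constructor
    · rw [neg_le_iff_add_nonneg, div_add_div _ _ (by positivity) (by positivity)]
      apply div_nonneg _ (by positivity)
      nlinarith [hv.1]
    · rw [div_le_div_iff₀ (by positivity) hR]
      nlinarith [hv.2]
  have hlower {R : ℝ} (hR : 0 < R) (y : ℝ) :
      f y * I R ≤ Real.exp (2 / R) * ∫ v, f (y + 1 / R + v / R ^ 2) * K v := by
    calc f y * I R = ∫ v in Set.Icc (-R) R, f y * K v := (integral_const_mul _ _).symm
      _ ≤ ∫ v in Set.Icc (-R) R, Real.exp (2 / R) * (f (y + 1 / R + v / R ^ 2) * K v) := by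
        refine setIntegral_mono_on (hKi.integrableOn.const_mul _)
          ((hint _ _).integrableOn.const_mul _) measurableSet_Icc fun v hv ↦ ?_
        rw [← mul_assoc, mul_comm (Real.exp _)]
        refine mul_le_mul_of_nonneg_right (hle ?_ ?_) (hK v)
        · linarith [(habs hR hv).1]
        · rw [show (2 : ℝ) / R = 1 / R + 1 / R by ring]
          linarith [(habs hR hv).2]
      _ ≤ _ := by
        rw [integral_const_mul]
        refine mul_le_mul_of_nonneg_left (setIntegral_le_integral (hint _ _)
          (ae_of_all _ fun v ↦ mul_nonneg (hf0 _) (hK v))) (Real.exp_pos _).le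
  have hupper {R : ℝ} (hR : 0 < R) (y : ℝ) :
      ∫ v, f (y - 1 / R + v / R ^ 2) * K v ≤
        f y * Real.exp (2 / R) * I R + B * (c - I R) := by
    have hcompl : c - I R = ∫ v in (Set.Icc (-R) R)ᶜ, K v := by
      rw [hc, ← integral_add_compl (measurableSet_Icc (a := -R) (b := R)) hKi]
      simp [hI]
    rw [← integral_add_compl (measurableSet_Icc (a := -R) (b := R)) (hint _ _), hcompl, hI]
    simp only
    rw [← integral_const_mul, ← integral_const_mul]
    refine add_le_add ?_ ?_
    · refine setIntegral_mono_on (hint _ _).integrableOn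
          (hKi.integrableOn.const_mul _) measurableSet_Icc fun v hv ↦ ?_
      refine mul_le_mul_of_nonneg_right (hle ?_ ?_) (hK v)
      · linarith [(habs hR hv).2]
      · rw [show (2 : ℝ) / R = 1 / R + 1 / R by ring]
        linarith [(habs hR hv).1]
    · exact integral_mono (hint _ _).integrableOn (hKi.integrableOn.const_mul _)
        fun v ↦ mul_le_mul_of_nonneg_right (hfB _) (hK v)
  have hinv : Tendsto (fun R : ℝ ↦ 1 / R) atTop (𝓝 0) := by
    simpa using tendsto_inv_atTop_zero (𝕜 := ℝ)
  have hexp : Tendsto (fun R : ℝ ↦ Real.exp (2 / R)) atTop (𝓝 1) := by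
    have := (Real.continuous_exp.tendsto _).comp (hinv.const_mul 2)
    simpa [Function.comp_def, div_eq_mul_inv] using this
  have hE1 : Tendsto (fun R ↦ Real.exp (2 / R) * (c + 1 / R) / I R) atTop (𝓝 1) := by
    have := (hexp.mul (hinv.const_add c)).div hIc hpos.ne'
    simpa [hpos.ne', Pi.div_def] using this
  have hE2 : Tendsto (fun R ↦ (c - 1 / R - B * (c - I R)) / (Real.exp (2 / R) * I R))
      atTop (𝓝 1) := by
    have := (((hinv.const_sub c).sub ((hIc.const_sub c).const_mul B)).div (hexp.mul hIc)
      (by simpa using hpos.ne'))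
    simpa [hpos.ne', Pi.div_def] using this
  rw [tendsto_order]
  constructor
  · intro a ha
    obtain ⟨R, hRa, hRI, hR⟩ := ((hE2.eventually_const_lt ha).and
      ((hIc.eventually_const_lt hpos).and (eventually_gt_atTop 0))).exists
    have hy := ((h (R ^ 2) (by positivity)).comp
      (tendsto_atTop_add_const_right _ (-(1 / R)) tendsto_id)).eventually_const_lt
      (show c - 1 / R < c from sub_lt_self _ (by positivity))
    filter_upwards [hy] with y hy
    refine hRa.trans_le ?_
    rw [div_le_iff₀ (mul_pos (Real.exp_pos _) hRI)]
    have := hupper hR y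
    simp only [Function.comp_apply, id, ← sub_eq_add_neg] at hy
    linarith
  · intro a ha
    obtain ⟨R, hRa, hRI, hR⟩ := ((hE1.eventually_lt_const ha).and
      ((hIc.eventually_const_lt hpos).and (eventually_gt_atTop 0))).exists
    have hy := ((h (R ^ 2) (by positivity)).comp
      (tendsto_atTop_add_const_right _ (1 / R) tendsto_id)).eventually_lt_const
      (show c < c + 1 / R from lt_add_of_pos_right _ (by positivity))
    filter_upwards [hy] with y hy
    refine lt_of_le_of_lt ?_ hRa
    rw [le_div_iff₀ hRI]
    refine (hlower hR y).trans ?_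
    exact mul_le_mul_of_nonneg_left hy.le (Real.exp_pos _).le

open MeasureTheory Complex Topology in
/-- A Tauberian theorem of Wiener–Ikehara type: if `f` is bounded, `f u * exp u` is monotone, and
the Laplace transform of `f - 1` extends continuously to the closed right half-plane, then `f`
converges to `1`. -/
theorem tendsto_one_of_laplace_continuousOn {f : ℝ → ℝ} {B : ℝ} (hf0 : ∀ u, 0 ≤ f u)
    (hfB : ∀ u, f u ≤ B) (hmono : Monotone fun u ↦ f u * Real.exp u)
    (hneg : ∀ u ≤ 0, f u = 0) {G : ℂ → ℂ} (hG : ContinuousOn G {s | 0 ≤ s.re})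
    (hfG : ∀ s : ℂ, 0 < s.re →
      ∫ u in Set.Ioi (0 : ℝ), ((f u - 1 : ℝ) : ℂ) * cexp (-s * u) = G s) :
    Tendsto f atTop (𝓝 1) := by
  have hfm : Measurable f := measurable_of_monotone_mul_exp hmono
  refine tendsto_one_of_tendsto_average hf0 hfB hmono fejerKernel_nonneg integrable_fejerKernel
    integral_fejerKernel_pos fun r hr ↦ ?_
  have hindm : Measurable ((Set.Ioi (0 : ℝ)).indicator (1 : ℝ → ℝ)) :=
    measurable_one.indicator measurableSet_Ioi
  have hind1 (u : ℝ) : ‖(Set.Ioi (0 : ℝ)).indicator (1 : ℝ → ℝ) u‖ ≤ 1 := by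
    simpa using norm_indicator_le_norm_self (s := Set.Ioi (0 : ℝ)) (1 : ℝ → ℝ) u
  have h1 : Tendsto (fun y ↦ ∫ v, (Set.Ioi (0 : ℝ)).indicator 1 (y + v / r) * fejerKernel v)
      atTop (𝓝 (∫ v, fejerKernel v)) := by
    refine tendsto_integral_filter_of_dominated_convergence fejerKernel
      (Eventually.of_forall fun y ↦ ?_) (Eventually.of_forall fun y ↦ ae_of_all _ fun v ↦ ?_)
      integrable_fejerKernel (ae_of_all _ fun v ↦ ?_)
    · have h := continuous_fejerKernel.measurable
      exact Measurable.aestronglyMeasurable (by fun_prop)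
    · rw [norm_mul, Real.norm_of_nonneg (fejerKernel_nonneg v)]
      exact mul_le_of_le_one_left (fejerKernel_nonneg v) (hind1 _)
    · refine tendsto_const_nhds.congr' ?_
      filter_upwards [eventually_gt_atTop (-(v / r))] with y hy
      rw [Set.indicator_of_mem (show y + v / r ∈ Set.Ioi (0 : ℝ) from by
        rw [Set.mem_Ioi]; linarith)]
      simp
  have hgC (u : ℝ) : |f u - 1| ≤ B + 1 := by
    rw [abs_le]
    constructor <;> linarith [hf0 u, hfB u]
  have h2 := (tendsto_integral_mul_fejerKernel (hfm.sub_const 1) hgC hG hfG hr).const_mul r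
  have h3 := h2.add h1
  simp only [mul_zero, zero_add] at h3
  refine h3.congr fun y ↦ ?_
  have hscale : r * ∫ u in Set.Ioi (0 : ℝ), (f u - 1) * fejerKernel (r * (u - y)) =
      ∫ v, (f (y + v / r) - (Set.Ioi (0 : ℝ)).indicator 1 (y + v / r)) * fejerKernel v := by
    rw [← integral_indicator measurableSet_Ioi, ← integral_add_left_eq_self _ y]
    have := Measure.integral_comp_div (fun w ↦ (Set.Ioi (0 : ℝ)).indicator
      (fun u ↦ (f u - 1) * fejerKernel (r * (u - y))) (y + w)) r
    rw [abs_of_pos hr, smul_eq_mul] at this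
    rw [← this]
    congr 1
    ext v
    by_cases hv : y + v / r ∈ Set.Ioi (0 : ℝ)
    · simp only [Set.indicator_of_mem hv, add_sub_cancel_left, Pi.one_apply,
        mul_div_cancel₀ v hr.ne']
    · simp only [Set.indicator_of_notMem hv, hneg _ (not_lt.1 hv), sub_zero, zero_mul]
  rw [hscale, ← integral_add]
  · congr 1
    ext v
    ring
  · refine integrable_fejerKernel.bdd_mul (c := B + 1)
      (Measurable.aestronglyMeasurable (by fun_prop)) (ae_of_all _ fun v ↦ ?_)
    refine (norm_sub_le _ _).trans (add_le_add ?_ (hind1 _))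
    rw [Real.norm_of_nonneg (hf0 _)]
    exact hfB _
  · exact integrable_fejerKernel.bdd_mul (c := 1)
      (Measurable.aestronglyMeasurable (by fun_prop)) (ae_of_all _ fun v ↦ hind1 _)

open Chebyshev ArithmeticFunction MeasureTheory in
/-- The Laplace transform of `ψ (exp u) * exp (-u) - 1`, in terms of the regular part at `1` of the
L-series of the von Mangoldt function. -/
lemma integral_psi_exp_sub_one_mul_exp {s : ℂ} (hs : 0 < s.re) :
    ∫ u in Set.Ioi (0 : ℝ),
        ((psi (Real.exp u) * Real.exp (-u) - 1 : ℝ) : ℂ) * Complex.exp (-s * u) =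
      (vonMangoldt.LFunctionResidueClassAux (1 : ZMod 1) (1 + s) - 1) / (1 + s) := by
  have hs1 : 1 < (1 + s).re := by simpa using hs
  have hs0 : s ≠ 0 := fun h ↦ by simp [h] at hs
  have hs2 : 1 + s ≠ 0 := fun h ↦ by simp [h] at hs1; linarith
  have hO : (fun n : ℕ ↦ ∑ k ∈ Finset.Icc 1 n, vonMangoldt k) =O[atTop]
      fun n : ℕ ↦ (n : ℝ) ^ (1 : ℝ) := by
    refine Asymptotics.IsBigO.of_bound (Real.log 4 + 4) (Eventually.of_forall fun n ↦ ?_)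
    have h := psi_le_const_mul_self (Nat.cast_nonneg n)
    have h0 := psi_nonneg n
    rw [psi, Nat.floor_natCast, ← Finset.Icc_add_one_left_eq_Ioc, zero_add] at h h0
    rw [Real.norm_of_nonneg h0, Real.rpow_one, Real.norm_of_nonneg (Nat.cast_nonneg n)]
    exact h
  have hL := LSeries_eq_mul_integral_of_nonneg _ zero_le_one hs1 hO fun n ↦ vonMangoldt_nonneg
  have hres : (fun n ↦ (vonMangoldt.residueClass (1 : ZMod 1) n : ℂ)) =
      fun n ↦ (vonMangoldt n : ℂ) := by
    ext n
    simp [vonMangoldt.residueClass, Subsingleton.elim (n : ZMod 1) 1]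
  have hAux := vonMangoldt.eqOn_LFunctionResidueClassAux (a := (1 : ZMod 1)) isUnit_one hs1
  simp only [hres] at hAux
  rw [hL] at hAux
  have hint : ∫ t in Set.Ioi (1 : ℝ), (∑ k ∈ Finset.Icc 1 ⌊t⌋₊, (vonMangoldt k : ℂ)) *
      (t : ℂ) ^ (-(1 + s + 1)) = ∫ u in Set.Ioi (0 : ℝ),
        ((psi (Real.exp u) * Real.exp (-u) : ℝ) : ℂ) * Complex.exp (-s * u) := by
    rw [← Real.exp_zero, ← integral_comp_exp_Ioi]
    refine integral_congr_ae (ae_of_all _ fun u ↦ ?_)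
    simp only [psi, Complex.real_smul]
    rw [Complex.cpow_def_of_ne_zero (by simp), ← Complex.ofReal_log (Real.exp_pos u).le,
      Real.log_exp, ← Finset.Icc_add_one_left_eq_Ioc, zero_add]
    push_cast
    rw [mul_assoc, ← Complex.exp_add, mul_left_comm, ← Complex.exp_add]
    congr 2
    ring
  have hexp := integral_exp_mul_complex_Ioi (a := -s) (by simpa using hs) 0
  have hi2 := integrableOn_exp_mul_complex_Ioi (a := -s) (by simpa using hs) 0
  have hi1 : IntegrableOn (fun u : ℝ ↦ ((psi (Real.exp u) * Real.exp (-u) : ℝ) : ℂ) *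
      Complex.exp (-s * u)) (Set.Ioi 0) := by
    refine hi2.bdd_mul (c := Real.log 4 + 4) ?_ (ae_of_all _ fun u ↦ ?_)
    · exact (Complex.measurable_ofReal.comp ((psi_mono.measurable.comp Real.measurable_exp).mul
        (Real.measurable_exp.comp measurable_neg))).aestronglyMeasurable
    · rw [Complex.norm_real, Real.norm_of_nonneg (mul_nonneg (psi_nonneg _) (Real.exp_pos _).le),
        Real.exp_neg, ← div_eq_mul_inv, div_le_iff₀ (Real.exp_pos _)]
      exact psi_le_const_mul_self (Real.exp_pos _).le
  simp only [Complex.ofReal_sub, Complex.ofReal_one, sub_mul, one_mul]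
  rw [integral_sub hi1 hi2, hexp, ← hint, hAux]
  simp
  field_simp
  ring

open Chebyshev ArithmeticFunction in
/-- The prime number theorem for Chebyshev's function `ψ`. -/
theorem tendsto_psi_div_self : Tendsto (fun x ↦ psi x / x) atTop (nhds 1) := by
  have h : Tendsto (fun u ↦ psi (Real.exp u) * Real.exp (-u)) atTop (nhds 1) := by
    refine tendsto_one_of_laplace_continuousOn (B := Real.log 4 + 4)
      (fun u ↦ mul_nonneg (psi_nonneg _) (Real.exp_pos _).le) (fun u ↦ ?_) ?_ (fun u hu ↦ ?_) ?_
      (fun s hs ↦ integral_psi_exp_sub_one_mul_exp hs)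
    · rw [Real.exp_neg, ← div_eq_mul_inv, div_le_iff₀ (Real.exp_pos _)]
      exact psi_le_const_mul_self (Real.exp_pos _).le
    · simpa [mul_assoc, ← Real.exp_add, Function.comp_def] using psi_mono.comp Real.exp_monotone
    · rw [psi_eq_zero_of_le_one (Real.exp_le_one_iff.2 hu), zero_mul]
    · refine ContinuousOn.div (ContinuousOn.sub ?_ continuousOn_const) (by fun_prop) ?_
      · refine (vonMangoldt.continuousOn_LFunctionResidueClassAux 1).comp (by fun_prop) ?_
        intro s (hs : 0 ≤ s.re)
        simpa using hs
      · intro s (hs : 0 ≤ s.re) h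
        have := congrArg Complex.re h
        simp at this
        linarith
  refine (h.comp Real.tendsto_log_atTop).congr' ?_
  filter_upwards [eventually_gt_atTop 0] with x hx
  simp [Real.exp_neg, Real.exp_log hx, div_eq_mul_inv]

open Chebyshev Asymptotics Topology in
/-- The prime number theorem for `π` follows from that for Chebyshev's function `ψ`. -/
lemma primeCounting_tendsto_of_psi (h : Tendsto (fun x ↦ psi x / x) atTop (𝓝 1)) :
    Tendsto (fun x : ℝ => (Nat.primeCounting ⌊x⌋₊ : ℝ) * Real.log x / x) atTop (𝓝 1) := by
  have h1 : Tendsto (fun x ↦ (psi x - theta x) / x) atTop (𝓝 0) := by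
    refine IsLittleO.tendsto_div_nhds_zero (isBigO_psi_sub_theta_sqrt.trans_isLittleO ?_)
    refine (isLittleO_iff_tendsto' ?_).2 ?_
    · filter_upwards [eventually_gt_atTop 0] with x hx h0
      exact absurd h0 hx.ne'
    · simp only [Real.sqrt_div_self]
      simpa [Function.comp_def] using tendsto_inv_atTop_zero.comp Real.tendsto_sqrt_atTop
  have h2 : Tendsto (fun x : ℝ ↦ ((Nat.primeCounting ⌊x⌋₊ : ℝ) - theta x / Real.log x) /
      (x / Real.log x)) atTop (𝓝 0) := by
    refine IsLittleO.tendsto_div_nhds_zero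
      (primeCounting_sub_theta_div_log_isBigO.trans_isLittleO ?_)
    have : (fun x : ℝ ↦ (Real.log x)⁻¹) =o[atTop] fun _ ↦ (1 : ℝ) :=
      (isLittleO_one_iff ℝ).2 (tendsto_inv_atTop_zero.comp Real.tendsto_log_atTop)
    refine ((isBigO_refl (fun x : ℝ ↦ x / Real.log x) atTop).mul_isLittleO this).congr ?_ ?_
    · intro x; ring
    · intro x; ring
  have h3 := (h.sub h1).add h2
  simp only [sub_zero, add_zero] at h3
  refine h3.congr' ?_
  filter_upwards [eventually_gt_atTop 1] with x hx
  have := Real.log_pos hx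
  field_simp
  ring

/-- Prime Number Theorem: `π(x) · log x / x → 1` as `x → ∞`, where `π(x)` is the number of
primes not exceeding `x`. -/
theorem primeCounting_mul_log_div_self_tendsto_one :
    Tendsto (fun x : ℝ => (Nat.primeCounting ⌊x⌋₊ : ℝ) * Real.log x / x)
      atTop (nhds 1) :=
  primeCounting_tendsto_of_psi tendsto_psi_div_self
end

section
/- (Hardy–Ramanujan theorem) Let (a_n) be any sequence of positive reals with a_n → ∞ as n → ∞. Then the proportion of integers N ∈ {1, 2, ..., n} satisfying |ω(N) − log log n| ≤ a_n · √(log log n) tends to 1 as n → ∞. -/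
open Filter

open Nat in
theorem log_factorial_eq_sum_primesLE (n : ℕ) :
    Real.log (n ! : ℝ) = ∑ p ∈ primesLE n, ((n !).factorization p : ℝ) * Real.log p := by
  rw [Real.log_nat_eq_sum_factorization]
  refine Finsupp.sum_of_support_subset _ (fun p hp => ?_) _ (by simp)
  rw [support_factorization, mem_primeFactors] at hp
  exact mem_primesLE.2 ⟨(hp.1.dvd_factorial).1 hp.2.1, hp.1⟩

open Nat in
theorem div_le_factorization_factorial {n p : ℕ} (hp : p.Prime) (hpn : p ≤ n) :
    n / p ≤ (n !).factorization p := by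
  rw [factorization_factorial hp (lt_succ_self (Nat.log p n))]
  have h1 : 0 < Nat.log p n := Nat.log_pos hp.one_lt hpn
  simpa using Finset.single_le_sum (f := fun i => n / p ^ i) (fun _ _ => Nat.zero_le _)
    (Finset.mem_Ico.2 ⟨le_rfl, by omega⟩ : 1 ∈ Finset.Ico 1 (Nat.log p n).succ)

theorem cast_div_sub_one_le_natDiv (n p : ℕ) : (n : ℝ) / p - 1 ≤ ((n / p : ℕ) : ℝ) := by
  rw [← Nat.floor_div_eq_div (K := ℝ)]
  exact (Nat.sub_one_lt_floor _).le

theorem log_div_mul_sub_one_le (p : ℕ) (hp : 2 ≤ p) :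
    Real.log p / (p * (p - 1)) ≤ 4 * (1 / (p : ℝ) ^ (3 / 2 : ℝ)) := by
  have hp' : (2 : ℝ) ≤ p := by exact_mod_cast hp
  have hlog := Real.log_le_rpow_div (x := p) (ε := 1 / 2) (by positivity) (by norm_num)
  have h0 : (0 : ℝ) < p := by linarith
  have hmul : (p : ℝ) ^ (1 / 2 : ℝ) * (p : ℝ) ^ (3 / 2 : ℝ) = p * p := by
    rw [← Real.rpow_add h0, ← sq, ← Real.rpow_natCast]; norm_num
  have h32 : 0 < (p : ℝ) ^ (3 / 2 : ℝ) := by positivity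
  rw [mul_one_div, div_le_div_iff₀ (by nlinarith) h32]
  calc Real.log p * (p : ℝ) ^ (3 / 2 : ℝ)
      ≤ ((p : ℝ) ^ (1 / 2 : ℝ) / (1 / 2)) * (p : ℝ) ^ (3 / 2 : ℝ) := by gcongr
    _ = 2 * (p * p) := by rw [← hmul]; ring
    _ ≤ 4 * (p * (p - 1)) := by nlinarith

/-- The sum of `1 / p` over the primes `p ≤ n`. -/
noncomputable def primeRecipSum (n : ℕ) : ℝ := ∑ p ∈ Nat.primesLE n, (1 : ℝ) / p

/-- The sum of `log p / p` over the primes `p ≤ n`. -/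
noncomputable def primeLogSum (n : ℕ) : ℝ := ∑ p ∈ Nat.primesLE n, Real.log p / p

theorem primeLogSum_le {n : ℕ} (hn : n ≠ 0) :
    primeLogSum n ≤ Real.log n + Real.log 4 := by
  have hn0 : (0 : ℝ) < n := by positivity
  have h1 : n * primeLogSum n - Chebyshev.theta n ≤ Real.log (n.factorial : ℝ) := by
    rw [log_factorial_eq_sum_primesLE, primeLogSum, Chebyshev.theta_eq_sum_primesLE_log,
      Finset.mul_sum, ← Finset.sum_sub_distrib]
    refine Finset.sum_le_sum fun p hp => ?_
    have hpp := Nat.prime_of_mem_primesLE hp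
    have h2 : (n : ℝ) / p - 1 ≤ (n.factorial.factorization p : ℝ) :=
      (cast_div_sub_one_le_natDiv n p).trans (by
        exact_mod_cast div_le_factorization_factorial hpp (Nat.le_of_mem_primesLE hp))
    calc (n : ℝ) * (Real.log p / p) - Real.log p = (n / p - 1) * Real.log p := by ring
      _ ≤ _ := mul_le_mul_of_nonneg_right h2 (Real.log_natCast_nonneg p)
  have h2 : Real.log (n.factorial : ℝ) ≤ n * Real.log n := by
    rw [← Real.log_pow]
    exact Real.log_le_log (by positivity) (by exact_mod_cast Nat.factorial_le_pow n)
  have h3 := Chebyshev.theta_le_log4_mul_x hn0.le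
  nlinarith

theorem exists_log_sub_le_primeLogSum :
    ∃ C : ℝ, ∀ n : ℕ, n ≠ 0 → Real.log n - C ≤ primeLogSum n := by
  have hs : Summable fun p : ℕ => 4 * (1 / (p : ℝ) ^ (3 / 2 : ℝ)) :=
    (Real.summable_one_div_nat_rpow.2 (by norm_num)).mul_left 4
  refine ⟨1 + ∑' p : ℕ, 4 * (1 / (p : ℝ) ^ (3 / 2 : ℝ)), fun n hn => ?_⟩
  have hn0 : (0 : ℝ) < n := by positivity
  have h1 : Real.log (n.factorial : ℝ) ≤
      n * primeLogSum n + n * ∑ p ∈ Nat.primesLE n, 4 * (1 / (p : ℝ) ^ (3 / 2 : ℝ)) := by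
    rw [log_factorial_eq_sum_primesLE, primeLogSum, Finset.mul_sum, Finset.mul_sum,
      ← Finset.sum_add_distrib]
    refine Finset.sum_le_sum fun p hp => ?_
    have hpp := Nat.prime_of_mem_primesLE hp
    have hp2 : (2 : ℝ) ≤ p := by exact_mod_cast hpp.two_le
    have hp1 : (0 : ℝ) < p - 1 := by linarith
    have h2 : (n.factorial.factorization p : ℝ) ≤ n / (p - 1) := by
      have h3 : (n.factorial.factorization p : ℝ) ≤ ((n / (p - 1) : ℕ) : ℝ) := by
        exact_mod_cast Nat.factorization_factorial_le_div_pred hpp n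
      refine h3.trans (Nat.cast_div_le.trans_eq ?_)
      rw [Nat.cast_pred hpp.pos]
    calc (n.factorial.factorization p : ℝ) * Real.log p ≤ n / (p - 1) * Real.log p :=
          mul_le_mul_of_nonneg_right h2 (Real.log_natCast_nonneg p)
      _ = n * (Real.log p / p) + n * (Real.log p / (p * (p - 1))) := by
          field_simp; ring
      _ ≤ _ := by
          gcongr
          exact log_div_mul_sub_one_le p hpp.two_le
  have h2 := hs.sum_le_tsum (Nat.primesLE n) fun p _ => by positivity
  have h3 := Stirling.le_log_factorial_stirling hn
  have h4 : 0 ≤ Real.log n := Real.log_natCast_nonneg n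
  have h5 : 0 ≤ Real.log (2 * Real.pi) := Real.log_nonneg (by linarith [Real.pi_gt_three])
  have h6 := mul_le_mul_of_nonneg_left h2 hn0.le
  refine le_of_mul_le_mul_left ?_ hn0
  linarith

/-- **Mertens' first theorem**. -/
theorem exists_abs_primeLogSum_sub_log_le :
    ∃ C : ℝ, ∀ n : ℕ, n ≠ 0 → |primeLogSum n - Real.log n| ≤ C := by
  obtain ⟨C, hC⟩ := exists_log_sub_le_primeLogSum
  refine ⟨max C (Real.log 4), fun n hn => abs_le.2 ⟨?_, ?_⟩⟩
  · linarith [hC n hn, le_max_left C (Real.log 4)]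
  · linarith [primeLogSum_le hn, le_max_right C (Real.log 4)]

theorem primeRecipSum_succ_sub {n : ℕ} (hn : n ≠ 0) :
    primeRecipSum (n + 1) - primeRecipSum n =
      (primeLogSum (n + 1) - primeLogSum n) / Real.log (n + 1 : ℕ) := by
  have hlog : Real.log (n + 1 : ℕ) ≠ 0 :=
    (Real.log_pos (by exact_mod_cast Nat.succ_lt_succ (Nat.pos_of_ne_zero hn))).ne'
  rw [primeRecipSum, primeRecipSum, primeLogSum, primeLogSum, Nat.primesLE_succ]
  split_ifs with h
  · rw [Finset.sum_insert (Nat.notMem_primesLE n), Finset.sum_insert (Nat.notMem_primesLE n)]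
    field_simp
    ring
  · simp

theorem sub_div_le_log_sub_log {x y : ℝ} (hx : 0 < x) (hy : 0 < y) :
    (y - x) / y ≤ Real.log y - Real.log x := by
  have h := Real.log_le_sub_one_of_pos (div_pos hx hy)
  rw [Real.log_div hx.ne' hy.ne'] at h
  have : (y - x) / y = 1 - x / y := by field_simp
  linarith

/-- **Mertens' second theorem**. -/
theorem exists_abs_primeRecipSum_sub_log_log_le :
    ∃ C : ℝ, ∀ n : ℕ, 2 ≤ n → |primeRecipSum n - Real.log (Real.log n)| ≤ C := by
  obtain ⟨C, hC⟩ := exists_abs_primeLogSum_sub_log_le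
  have hC0 : 0 ≤ C := (abs_nonneg _).trans (hC 1 one_ne_zero)
  set R : ℕ → ℝ := fun n => primeLogSum n - Real.log n with hR
  set U : ℕ → ℝ := fun n =>
    primeRecipSum n - Real.log (Real.log n) - R n / Real.log n with hU
  have hlog : ∀ n : ℕ, 2 ≤ n → 0 < Real.log n := fun n hn =>
    Real.log_pos (by exact_mod_cast hn)
  have hstep : ∀ n : ℕ, 2 ≤ n →
      |U (n + 1) - U n| ≤ (C + 1) * (1 / Real.log n - 1 / Real.log (n + 1 : ℕ)) := by
    intro n hn
    have hn0 : (0 : ℝ) < n := by positivity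
    have hl := hlog n hn
    have hl' := hlog (n + 1) (by omega)
    have hΔ : Real.log (n + 1 : ℕ) - Real.log n ≤ 1 := by
      have h := sub_div_le_log_sub_log (x := ((n + 1 : ℕ) : ℝ)) (y := n) (by positivity) hn0
      have h2 : ((n : ℝ) - (n + 1 : ℕ)) / n = -(1 / n) := by push_cast; ring
      have h3 : 1 / (n : ℝ) ≤ 1 := (div_le_one hn0).2 (by exact_mod_cast (by omega : 1 ≤ n))
      linarith
    have hΔ0 : 0 ≤ Real.log (n + 1 : ℕ) - Real.log n :=
      sub_nonneg.2 (Real.log_le_log hn0 (by exact_mod_cast n.le_succ))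
    have hS := primeRecipSum_succ_sub (n := n) (by omega)
    have hRn := abs_le.1 (hC n (by omega))
    have lo := sub_div_le_log_sub_log hl hl'
    have hi := sub_div_le_log_sub_log hl' hl
    set l := Real.log n
    set l' := Real.log (n + 1 : ℕ)
    have hD : 0 ≤ 1 / l - 1 / l' :=
      sub_nonneg.2 (one_div_le_one_div_of_le hl (by linarith))
    have key : U (n + 1) - U n = R n * (1 / l - 1 / l') +
        ((l' - l) / l' - (Real.log l' - Real.log l)) := by
      have : primeRecipSum (n + 1) = primeRecipSum n +
        (primeLogSum (n + 1) - primeLogSum n) / l' := by linarith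
      simp only [hU, hR, this]
      change _ + _ - Real.log l' - (primeLogSum (n + 1) - l') / l' -
        (_ - Real.log l - (_ - l) / l) = (_ - l) * _ + _
      field_simp
      ring
    have hbr : -(1 / l - 1 / l') ≤ (l' - l) / l' - (Real.log l' - Real.log l) := by
      have e1 : (l' - l) / l' - (l' - l) / l = -((l' - l) * (1 / l - 1 / l')) := by
        field_simp; ring
      have e2 : (l - l') / l = -((l' - l) / l) := by ring
      nlinarith
    rw [key, abs_le]
    constructor <;> nlinarith
  have hind : ∀ n : ℕ, 2 ≤ n →
      |U n - U 2| ≤ (C + 1) * (1 / Real.log (2 : ℕ) - 1 / Real.log n) := by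
    intro n hn
    induction n, hn using Nat.le_induction with
    | base => simp
    | succ n hn ih =>
      have h := abs_add_le (U (n + 1) - U n) (U n - U 2)
      rw [sub_add_sub_cancel] at h
      linarith [hstep n hn]
  refine ⟨|U 2| + (C + 1) * (1 / Real.log (2 : ℕ)) + C / Real.log (2 : ℕ), fun n hn => ?_⟩
  have hl := hlog n hn
  have h1 := hind n hn
  have h2 : |R n / Real.log n| ≤ C / Real.log (2 : ℕ) := by
    rw [abs_div, abs_of_pos hl]
    exact div_le_div₀ hC0 (hC n (by omega)) (hlog 2 le_rfl)
      (Real.log_le_log (by norm_num) (by exact_mod_cast hn))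
  have h3 : primeRecipSum n - Real.log (Real.log n) = U 2 + (U n - U 2) + R n / Real.log n := by
    simp only [hU]; ring
  have h4 : 0 ≤ (C + 1) * (1 / Real.log n) := by positivity
  rw [h3]
  refine (abs_add_three _ _ _).trans ?_
  linarith

theorem primeRecipSum_nonneg (n : ℕ) : 0 ≤ primeRecipSum n :=
  Finset.sum_nonneg fun _ _ => by positivity

theorem card_primeFactors_eq_sum {n N : ℕ} (hN : N ∈ Finset.Icc 1 n) :
    (N.primeFactors.card : ℝ) = ∑ p ∈ Nat.primesLE n, if p ∣ N then (1 : ℝ) else 0 := by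
  rw [Finset.sum_boole]
  congr 2
  obtain ⟨h1, h2⟩ := Finset.mem_Icc.1 hN
  ext p
  simp only [Nat.mem_primeFactors, Finset.mem_filter, Nat.mem_primesLE]
  exact ⟨fun h => ⟨⟨(Nat.le_of_dvd h1 h.2.1).trans h2, h.1⟩, h.2.1⟩,
    fun h => ⟨h.1.2, h.2, by omega⟩⟩

theorem sum_Icc_ite_dvd (n d : ℕ) :
    ∑ N ∈ Finset.Icc 1 n, (if d ∣ N then (1 : ℝ) else 0) = ((n / d : ℕ) : ℝ) := by
  rw [Finset.sum_boole, ← Nat.Ioc_filter_dvd_card_eq_div]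
  rfl

theorem mul_primeRecipSum_sub_le_sum_card_primeFactors (n : ℕ) :
    n * primeRecipSum n - n ≤ ∑ N ∈ Finset.Icc 1 n, (N.primeFactors.card : ℝ) := by
  have hcard : ((Nat.primesLE n).card : ℝ) ≤ n := by
    rw [Nat.primesLE_eq_filter_Icc_one]
    exact_mod_cast (Finset.card_filter_le _ _).trans_eq (by simp)
  rw [Finset.sum_congr rfl fun N hN => card_primeFactors_eq_sum hN, Finset.sum_comm]
  calc n * primeRecipSum n - n ≤ ∑ p ∈ Nat.primesLE n, ((n : ℝ) / p - 1) := by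
        rw [Finset.sum_sub_distrib, primeRecipSum, Finset.mul_sum]
        simp only [mul_one_div, Finset.sum_const, nsmul_eq_mul, mul_one]
        linarith
    _ ≤ _ := Finset.sum_le_sum fun p _ => by
        rw [sum_Icc_ite_dvd]
        exact cast_div_sub_one_le_natDiv n p

theorem sum_card_primeFactors_sq_le (n : ℕ) :
    ∑ N ∈ Finset.Icc 1 n, (N.primeFactors.card : ℝ) ^ 2 ≤
      n * primeRecipSum n ^ 2 + n * primeRecipSum n := by
  have hsq : ∀ N ∈ Finset.Icc 1 n, (N.primeFactors.card : ℝ) ^ 2 =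
      ∑ p ∈ Nat.primesLE n, ∑ q ∈ Nat.primesLE n,
        (if p ∣ N then (1 : ℝ) else 0) * (if q ∣ N then (1 : ℝ) else 0) := fun N hN => by
    rw [card_primeFactors_eq_sum hN, sq, Finset.sum_mul_sum]
  have hpair : ∀ p ∈ Nat.primesLE n, ∀ q ∈ Nat.primesLE n,
      ∑ N ∈ Finset.Icc 1 n, (if p ∣ N then (1 : ℝ) else 0) * (if q ∣ N then (1 : ℝ) else 0) ≤
        n * (1 / p * (1 / q)) + if p = q then (n : ℝ) * (1 / p) else 0 := by
    intro p hp q hq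
    have hite : ∀ N : ℕ, (if p ∣ N then (1 : ℝ) else 0) * (if q ∣ N then (1 : ℝ) else 0) =
        if p.lcm q ∣ N then 1 else 0 := fun N => by
      simp only [Nat.lcm_dvd_iff, ite_and]
      split_ifs <;> simp
    simp only [hite, sum_Icc_ite_dvd]
    refine Nat.cast_div_le.trans ?_
    split_ifs with h
    · subst h
      rw [Nat.lcm_self]
      have : (0 : ℝ) ≤ n * (1 / p * (1 / p)) := by positivity
      rw [← mul_one_div (n : ℝ) (p : ℝ)]
      linarith
    · rw [((Nat.coprime_primes (Nat.prime_of_mem_primesLE hp)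
        (Nat.prime_of_mem_primesLE hq)).2 h).lcm_eq_mul]
      push_cast
      rw [add_zero, one_div_mul_one_div, mul_one_div]
  rw [Finset.sum_congr rfl hsq, Finset.sum_comm]
  calc _ ≤ ∑ p ∈ Nat.primesLE n, ∑ q ∈ Nat.primesLE n,
        (n * (1 / p * (1 / q)) + if p = q then (n : ℝ) * (1 / p) else 0) := by
        refine Finset.sum_le_sum fun p hp => ?_
        rw [Finset.sum_comm]
        exact Finset.sum_le_sum fun q hq => hpair p hp q hq
    _ = _ := by
        simp only [Finset.sum_add_distrib, ← Finset.mul_sum, primeRecipSum, sq,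
          Finset.sum_mul_sum]
        congr 1
        rw [Finset.mul_sum]
        exact Finset.sum_congr rfl fun p hp => by simp [hp]

/-- The **Turán inequality** for the number of distinct prime factors. -/
theorem sum_sq_card_primeFactors_sub_primeRecipSum_le (n : ℕ) :
    ∑ N ∈ Finset.Icc 1 n, ((N.primeFactors.card : ℝ) - primeRecipSum n) ^ 2 ≤
      3 * (n * primeRecipSum n) := by
  have h1 := mul_primeRecipSum_sub_le_sum_card_primeFactors n
  have h2 := sum_card_primeFactors_sq_le n
  have h3 := primeRecipSum_nonneg n
  have h4 := mul_le_mul_of_nonneg_left h1 h3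
  have h5 : ∑ N ∈ Finset.Icc 1 n, ((N.primeFactors.card : ℝ) - primeRecipSum n) ^ 2 =
      ∑ N ∈ Finset.Icc 1 n, (N.primeFactors.card : ℝ) ^ 2 -
        2 * (primeRecipSum n * ∑ N ∈ Finset.Icc 1 n, (N.primeFactors.card : ℝ)) +
        n * primeRecipSum n ^ 2 := by
    simp only [sub_sq, Finset.sum_add_distrib, Finset.sum_sub_distrib, Finset.sum_const,
      Nat.card_Icc, Nat.add_sub_cancel, nsmul_eq_mul, Finset.mul_sum]
    congr 2
    exact Finset.sum_congr rfl fun _ _ => by ring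
  rw [h5]
  linarith

/-- The **Chebyshev inequality** for a finite sum of squares. -/
theorem card_filter_lt_abs_mul_sq_le {ι : Type*} (s : Finset ι) (f : ι → ℝ) {t : ℝ}
    (ht : 0 ≤ t) : ((s.filter fun i => t < |f i|).card : ℝ) * t ^ 2 ≤ ∑ i ∈ s, f i ^ 2 := by
  rw [← nsmul_eq_mul]
  refine (Finset.card_nsmul_le_sum _ (fun i => f i ^ 2) _ fun i hi => ?_).trans
    (Finset.sum_le_sum_of_subset_of_nonneg (Finset.filter_subset _ _) fun _ _ _ => sq_nonneg _)
  rw [← sq_abs (f i)]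
  exact pow_le_pow_left₀ ht (Finset.mem_filter.1 hi).2.le 2

theorem one_sub_le_card_filter_div {n : ℕ} (hn : n ≠ 0) {C b : ℝ} (hb : 0 < b)
    (hC : |primeRecipSum n - Real.log (Real.log n)| ≤ C)
    (hCL : C ≤ Real.log (Real.log n)) (hL : 0 < Real.log (Real.log n))
    (hCb : 2 * C ≤ b * Real.sqrt (Real.log (Real.log n))) :
    1 - 24 / b ^ 2 ≤ (((Finset.Icc 1 n).filter fun N : ℕ =>
      |(N.primeFactors.card : ℝ) - Real.log (Real.log n)| ≤
        b * Real.sqrt (Real.log (Real.log n))).card : ℝ) / n := by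
  set L := Real.log (Real.log n)
  have hn0 : (0 : ℝ) < n := by positivity
  have hsqrt : Real.sqrt L ^ 2 = L := Real.sq_sqrt hL.le
  have hS : primeRecipSum n ≤ 2 * L := by linarith [(abs_le.1 hC).2]
  set B := (Finset.Icc 1 n).filter fun N : ℕ =>
    b * Real.sqrt L / 2 < |(N.primeFactors.card : ℝ) - primeRecipSum n| with hB
  set G := (Finset.Icc 1 n).filter fun N : ℕ =>
    |(N.primeFactors.card : ℝ) - L| ≤ b * Real.sqrt L with hG
  have hcheb : (B.card : ℝ) * (b * Real.sqrt L / 2) ^ 2 ≤ 3 * (n * primeRecipSum n) :=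
    (card_filter_lt_abs_mul_sq_le _ _ (by positivity)).trans
      (sum_sq_card_primeFactors_sub_primeRecipSum_le n)
  have hBn : (B.card : ℝ) / n ≤ 24 / b ^ 2 := by
    rw [div_le_div_iff₀ hn0 (by positivity)]
    refine le_of_mul_le_mul_right ?_ hL
    have e : (b * Real.sqrt L / 2) ^ 2 = b ^ 2 * L / 4 := by
      rw [div_pow, mul_pow, hsqrt]; norm_num
    rw [e] at hcheb
    have := mul_le_mul_of_nonneg_left hS hn0.le
    linarith
  have hcover : Finset.Icc 1 n ⊆ G ∪ B := by
    intro N hN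
    rw [Finset.mem_union, hG, hB, Finset.mem_filter, Finset.mem_filter]
    by_contra! h
    have h1 := h.1 hN
    have h2 := h.2 hN
    have h3 := abs_sub_le (N.primeFactors.card : ℝ) (primeRecipSum n) L
    linarith
  have hcard : (n : ℝ) ≤ G.card + B.card := by
    have := (Finset.card_le_card hcover).trans (Finset.card_union_le _ _)
    rw [Nat.card_Icc, Nat.add_sub_cancel] at this
    exact_mod_cast this
  have : 1 ≤ (G.card : ℝ) / n + B.card / n := by
    rw [← add_div, one_le_div hn0]
    exact hcard
  linarith

/-- Hardy–Ramanujan theorem: for any sequence `a_n → ∞` of positive reals, the proportion of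
`N ∈ {1, …, n}` with `|ω(N) − log log n| ≤ a_n · √(log log n)` tends to `1`. -/
theorem hardy_ramanujan (a : ℕ → ℝ) (ha : ∀ n, 0 < a n) (hlim : Tendsto a atTop atTop) :
    Tendsto
      (fun n : ℕ =>
        (((Finset.Icc 1 n).filter fun N : ℕ =>
            |(N.primeFactors.card : ℝ) - Real.log (Real.log n)| ≤
              a n * Real.sqrt (Real.log (Real.log n))).card : ℝ) / n)
      atTop (nhds 1) := by
  obtain ⟨C, hC⟩ := exists_abs_primeRecipSum_sub_log_log_le
  have hL : Tendsto (fun n : ℕ => Real.log (Real.log n)) atTop atTop :=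
    Real.tendsto_log_atTop.comp (Real.tendsto_log_atTop.comp tendsto_natCast_atTop_atTop)
  have haL : Tendsto (fun n : ℕ => a n * Real.sqrt (Real.log (Real.log n))) atTop atTop :=
    hlim.atTop_mul_atTop₀ (Real.tendsto_sqrt_atTop.comp hL)
  have hlow : Tendsto (fun n : ℕ => 1 - 24 / a n ^ 2) atTop (nhds 1) := by
    simpa using ((tendsto_pow_atTop two_ne_zero).comp hlim).const_div_atTop 24 |>.const_sub 1
  refine tendsto_of_tendsto_of_tendsto_of_le_of_le' hlow tendsto_const_nhds ?_ ?_
  · filter_upwards [eventually_ge_atTop 2, hL.eventually_ge_atTop C, hL.eventually_gt_atTop 0,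
      haL.eventually_ge_atTop (2 * C)] with n hn hCL hL0 hCb
    exact one_sub_le_card_filter_div (by omega) (ha n) (hC n hn) hCL hL0 hCb
  · refine Eventually.of_forall fun n => div_le_one_of_le₀ ?_ (Nat.cast_nonneg n)
    exact_mod_cast (Finset.card_filter_le _ _).trans_eq (by simp)
end

section
/- (Mertens' second theorem) There exists a constant C > 0 such that for all integers n ≥ 3, |Σ_{p ≤ n, p prime} 1/p − log log n| ≤ C. -/
open Finset in
theorem log_factorial_eq_sum_primes (n : ℕ) :
    Real.log (n.factorial) =
      ∑ p ∈ (Icc 1 n).filter Nat.Prime, (n.factorial.factorization p : ℝ) * Real.log p := by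
  rw [Real.log_nat_eq_sum_factorization]
  refine Finsupp.sum_of_support_subset _ (fun p hp => ?_) _ (by simp)
  rw [Nat.support_factorization, Nat.mem_primeFactors] at hp
  rw [mem_filter, mem_Icc]
  exact ⟨⟨hp.1.one_lt.le, hp.1.dvd_factorial.1 hp.2.1⟩, hp.1⟩

theorem div_sub_one_le_factorization_factorial {p : ℕ} (hp : p.Prime) (n : ℕ) :
    (n : ℝ) / p - 1 ≤ n.factorial.factorization p := by
  have h : n / p ≤ n.factorial.factorization p := by
    rw [Nat.factorization_factorial hp (b := Nat.log p n + 2) (by lia)]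
    refine le_trans (by simp) (Finset.single_le_sum (f := fun i => n / p ^ i) (a := 1)
      (fun _ _ => Nat.zero_le _) (by simp))
  have h1 : (n : ℝ) / p < (n / p : ℕ) + 1 := by
    rw [← Nat.floor_div_eq_div (K := ℝ)]
    exact Nat.lt_floor_add_one _
  have h2 : ((n / p : ℕ) : ℝ) ≤ n.factorial.factorization p := by exact_mod_cast h
  linarith

theorem factorization_factorial_le_div_sub_one {p : ℕ} (hp : p.Prime) (n : ℕ) :
    (n.factorial.factorization p : ℝ) ≤ n / ((p : ℝ) - 1) := by
  have hp1 : (1 : ℝ) < p := by exact_mod_cast hp.one_lt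
  rw [le_div_iff₀ (by linarith)]
  have h : (p - 1) * n.factorial.factorization p ≤ n := by
    rw [Nat.sub_one_mul_factorization_factorial hp]
    exact Nat.sub_le _ _
  have h' : (((p - 1 : ℕ) : ℝ)) * n.factorial.factorization p ≤ n := by exact_mod_cast h
  rw [Nat.cast_sub hp.one_lt.le, Nat.cast_one] at h'
  linarith

theorem mul_log_sub_le_log_factorial {n : ℕ} (hn : 1 ≤ n) :
    (n : ℝ) * Real.log n - n ≤ Real.log n.factorial := by
  have hn0 : (0 : ℝ) < n := by exact_mod_cast hn
  have h := Real.log_le_log (by positivity) (Real.pow_div_factorial_le_exp (n : ℝ) hn0.le n)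
  rw [Real.log_div (by positivity) (by positivity), Real.log_pow, Real.log_exp] at h
  linarith

theorem log_factorial_le_mul_log (n : ℕ) : Real.log n.factorial ≤ n * Real.log n := by
  rw [← Real.log_pow]
  refine Real.log_le_log (by positivity) ?_
  exact_mod_cast Nat.factorial_le_pow n

/-- The error made by replacing `log p / (p - 1)` with `log p / p` is `O(p ^ (-3 / 2))`. -/
theorem log_div_sub_one_sub_le {p : ℕ} (hp : 2 ≤ p) :
    Real.log p / ((p : ℝ) - 1) - Real.log p / p ≤ 4 * (1 / (p : ℝ) ^ (3 / 2 : ℝ)) := by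
  have hp2 : (2 : ℝ) ≤ p := by exact_mod_cast hp
  have hp0 : (0 : ℝ) < p := by linarith
  have hlog : Real.log p ≤ 2 * (p : ℝ) ^ (1 / 2 : ℝ) := by
    have := Real.log_le_rpow_div hp0.le (ε := 1 / 2) (by norm_num)
    linarith
  have hlog0 : 0 ≤ Real.log p := Real.log_nonneg (by linarith)
  calc Real.log p / ((p : ℝ) - 1) - Real.log p / p
      = Real.log p / (((p : ℝ) - 1) * p) := by
        have : (p : ℝ) - 1 ≠ 0 := by linarith
        field_simp
        ring
    _ ≤ (2 * (p : ℝ) ^ (1 / 2 : ℝ)) / ((p : ℝ) / 2 * p) := by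
        gcongr
        linarith
    _ = 4 * (1 / (p : ℝ) ^ (3 / 2 : ℝ)) := by
        have h : (p : ℝ) * p = (p : ℝ) ^ (3 / 2 : ℝ) * (p : ℝ) ^ (1 / 2 : ℝ) := by
          rw [← Real.rpow_add hp0, ← pow_two, ← Real.rpow_natCast]
          norm_num
        have h1 : (0 : ℝ) < (p : ℝ) ^ (1 / 2 : ℝ) := by positivity
        have h2 : (0 : ℝ) < (p : ℝ) ^ (3 / 2 : ℝ) := by positivity
        rw [div_mul_eq_mul_div, h]
        field_simp
        norm_num

/-- Mertens' first theorem: `∑_{p ≤ n} log p / p = log n + O(1)`. -/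
theorem mertens_first :
    ∃ K : ℝ, ∀ n : ℕ, 1 ≤ n →
      |(∑ p ∈ (Finset.Icc 1 n).filter Nat.Prime, Real.log p / p) - Real.log n| ≤ K := by
  have hsum : Summable fun m : ℕ => 1 / (m : ℝ) ^ (3 / 2 : ℝ) :=
    Real.summable_one_div_nat_rpow.2 (by norm_num)
  refine ⟨max (Real.log 4) (1 + 4 * ∑' m : ℕ, 1 / (m : ℝ) ^ (3 / 2 : ℝ)), fun n hn => ?_⟩
  have hn0 : (0 : ℝ) < n := by exact_mod_cast hn
  have hlog : ∀ p : ℕ, 0 ≤ Real.log (p : ℝ) := Real.log_natCast_nonneg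
  set M := ∑ p ∈ (Finset.Icc 1 n).filter Nat.Prime, Real.log p / p with hM
  have hprime : ∀ p ∈ (Finset.Icc 1 n).filter Nat.Prime, p.Prime :=
    fun p hp => (Finset.mem_filter.1 hp).2
  have hupper : M - Real.log n ≤ Real.log 4 := by
    have h : n * M - Chebyshev.theta n ≤ Real.log n.factorial := by
      rw [log_factorial_eq_sum_primes, Chebyshev.theta, Nat.floor_natCast, hM, Finset.mul_sum,
        ← Finset.Icc_add_one_left_eq_Ioc, zero_add, ← Finset.sum_sub_distrib]
      refine Finset.sum_le_sum fun p hp => ?_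
      have := mul_le_mul_of_nonneg_right
        (div_sub_one_le_factorization_factorial (hprime p hp) n) (hlog p)
      calc _ = ((n : ℝ) / p - 1) * Real.log p := by ring
        _ ≤ _ := this
    have h1 := log_factorial_le_mul_log n
    have h2 := Chebyshev.theta_le_log4_mul_x hn0.le
    refine le_of_mul_le_mul_left ?_ hn0
    linarith
  have hlower : Real.log n - M ≤ 1 + 4 * ∑' m : ℕ, 1 / (m : ℝ) ^ (3 / 2 : ℝ) := by
    have h : Real.log n.factorial ≤ n * (M + 4 * ∑' m : ℕ, 1 / (m : ℝ) ^ (3 / 2 : ℝ)) := by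
      calc Real.log n.factorial
          ≤ ∑ p ∈ (Finset.Icc 1 n).filter Nat.Prime,
              n * (Real.log p / p + 4 * (1 / (p : ℝ) ^ (3 / 2 : ℝ))) := by
            rw [log_factorial_eq_sum_primes]
            refine Finset.sum_le_sum fun p hp => ?_
            calc _ ≤ (n : ℝ) / ((p : ℝ) - 1) * Real.log p :=
                  mul_le_mul_of_nonneg_right
                    (factorization_factorial_le_div_sub_one (hprime p hp) n) (hlog p)
              _ = n * (Real.log p / ((p : ℝ) - 1)) := by ring
              _ ≤ _ := by
                  have := log_div_sub_one_sub_le (hprime p hp).two_le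
                  gcongr
                  linarith
        _ ≤ _ := by
            rw [← Finset.mul_sum, Finset.sum_add_distrib, ← Finset.mul_sum]
            gcongr
            exact hsum.sum_le_tsum _ fun _ _ => by positivity
    have h1 := mul_log_sub_le_log_factorial hn
    refine le_of_mul_le_mul_left ?_ hn0
    linarith
  rw [abs_le]
  constructor
  · linarith [le_max_right (Real.log 4) (1 + 4 * ∑' m : ℕ, 1 / (m : ℝ) ^ (3 / 2 : ℝ))]
  · exact hupper.trans (le_max_left _ _)

theorem sum_primes_Icc_succ (f : ℕ → ℝ) (n : ℕ) :
    ∑ p ∈ (Finset.Icc 1 (n + 1)).filter Nat.Prime, f p =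
      (∑ p ∈ (Finset.Icc 1 n).filter Nat.Prime, f p) +
        if (n + 1).Prime then f (n + 1) else 0 := by
  rw [Finset.sum_filter, Finset.sum_filter, Finset.sum_Icc_succ_top (by lia)]

/-- One step of the partial summation comparing `∑ a / y` with `log y`. -/
theorem abs_partial_summation_step_le {x y e e' K : ℝ} (hx : 0 < x) (hxy : x ≤ y)
    (hy : y ≤ x + 1) (he : |e| ≤ K) :
    |((y - x + (e' - e)) / y - e' / y - Real.log y) - (-(e / x) - Real.log x)| ≤
      (K + 1) * (1 / x - 1 / y) := by
  have hy0 : 0 < y := by linarith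
  have hinv : 0 ≤ 1 / x - 1 / y := sub_nonneg.2 (one_div_le_one_div_of_le hx hxy)
  have hlogsub : Real.log (y / x) = Real.log y - Real.log x := Real.log_div hy0.ne' hx.ne'
  have hup := Real.log_le_sub_one_of_pos (div_pos hy0 hx)
  have hlo := Real.one_sub_inv_le_log_of_pos (div_pos hy0 hx)
  have hdiv : y / x - 1 - (1 - x / y) = (y - x) * (1 / x - 1 / y) := by
    field_simp
  rw [inv_div] at hlo
  have hle : (y - x) * (1 / x - 1 / y) ≤ 1 / x - 1 / y := by
    nlinarith
  have hE : |e * (1 / x - 1 / y)| ≤ K * (1 / x - 1 / y) := by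
    rw [abs_mul, abs_of_nonneg hinv]
    gcongr
  have hrw : ((y - x + (e' - e)) / y - e' / y - Real.log y) - (-(e / x) - Real.log x) =
      (1 - x / y - Real.log (y / x)) + e * (1 / x - 1 / y) := by
    rw [hlogsub]
    field_simp
    ring
  rw [hrw, add_mul, one_mul, add_comm (K * _)]
  refine (abs_add_le _ _).trans (add_le_add ?_ hE)
  rw [abs_le]
  constructor <;> linarith

/-- Mertens' second theorem: `∑_{p ≤ n} 1/p = log log n + O(1)`. -/
theorem mertens_second :
    ∃ C : ℝ, 0 < C ∧ ∀ n : ℕ, 3 ≤ n →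
      |(∑ p ∈ (Finset.Icc 1 n).filter Nat.Prime, (1 : ℝ) / p) -
          Real.log (Real.log n)| ≤ C := by
  obtain ⟨K, hK⟩ := mertens_first
  set S : ℕ → ℝ := fun n => ∑ p ∈ (Finset.Icc 1 n).filter Nat.Prime, (1 : ℝ) / p with hS
  set M : ℕ → ℝ := fun n => ∑ p ∈ (Finset.Icc 1 n).filter Nat.Prime, Real.log p / p with hM
  have hK0 : 0 ≤ K := (abs_nonneg _).trans (hK 1 le_rfl)
  set T : ℕ → ℝ := fun n => S n - (M n - Real.log n) / Real.log n - Real.log (Real.log n) with hT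
  have hlog2 : 0 < Real.log 2 := Real.log_pos (by norm_num)
  have hbound : ∀ n : ℕ, 2 ≤ n →
      |T n - T 2| ≤ (K + 1) * (1 / Real.log 2 - 1 / Real.log n) := by
    intro n hn
    induction n, hn using Nat.le_induction with
    | base => simp
    | succ n hn ih =>
      have hn2 : (2 : ℝ) ≤ n := by exact_mod_cast hn
      have hx : 0 < Real.log n := Real.log_pos (by linarith)
      have hxy : Real.log n ≤ Real.log (n + 1 : ℕ) :=
        Real.log_le_log (by linarith) (by push_cast; linarith)
      have hy : Real.log (n + 1 : ℕ) ≤ Real.log n + 1 := by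
        rw [← sub_le_iff_le_add', ← Real.log_div (by positivity) (by positivity)]
        refine (Real.log_le_sub_one_of_pos (by positivity)).trans ?_
        rw [sub_le_iff_le_add, div_le_iff₀ (by linarith)]
        push_cast
        linarith
      have hy0 : 0 < Real.log (n + 1 : ℕ) := hx.trans_le hxy
      have hstep : S (n + 1) - S n = (M (n + 1) - M n) / Real.log (n + 1 : ℕ) := by
        simp only [hS, hM, sum_primes_Icc_succ, add_sub_cancel_left]
        split_ifs
        · rw [div_div, mul_comm, ← div_div, div_self hy0.ne']
        · simp
      have h := abs_partial_summation_step_le (e' := M (n + 1) - Real.log (n + 1 : ℕ)) hx hxy hy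
        (hK n (by lia))
      have heq : T (n + 1) - T n =
          ((Real.log (n + 1 : ℕ) - Real.log n +
              ((M (n + 1) - Real.log (n + 1 : ℕ)) - (M n - Real.log n))) / Real.log (n + 1 : ℕ) -
            (M (n + 1) - Real.log (n + 1 : ℕ)) / Real.log (n + 1 : ℕ) -
            Real.log (Real.log (n + 1 : ℕ))) -
          (-((M n - Real.log n) / Real.log n) - Real.log (Real.log n)) := by
        have hnum : Real.log (n + 1 : ℕ) - Real.log n +
            ((M (n + 1) - Real.log (n + 1 : ℕ)) - (M n - Real.log n)) = M (n + 1) - M n := by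
          ring
        rw [hnum, ← hstep]
        simp only [hT]
        ring
      rw [← heq] at h
      calc |T (n + 1) - T 2| ≤ |T (n + 1) - T n| + |T n - T 2| := abs_sub_le _ _ _
        _ ≤ _ := add_le_add h ih
        _ = _ := by ring
  refine ⟨|T 2| + (K + 1) / Real.log 2 + K / Real.log 2 + 1, by positivity, fun n hn => ?_⟩
  have hlogn : Real.log 2 ≤ Real.log n :=
    Real.log_le_log (by norm_num) (by exact_mod_cast (by lia : 2 ≤ n))
  have hlogn0 : 0 < Real.log n := hlog2.trans_le hlogn
  have h1 : |T n - T 2| ≤ (K + 1) / Real.log 2 := by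
    refine (hbound n (by lia)).trans ?_
    rw [div_eq_mul_one_div (K + 1)]
    gcongr
    linarith [one_div_pos.2 hlogn0]
  have h2 : |(M n - Real.log n) / Real.log n| ≤ K / Real.log 2 := by
    rw [abs_div, abs_of_pos hlogn0]
    exact div_le_div₀ hK0 (hK n (by lia)) hlog2 hlogn
  have h3 : S n - Real.log (Real.log n) =
      T 2 + (T n - T 2) + (M n - Real.log n) / Real.log n := by
    simp only [hT]
    ring
  calc |S n - Real.log (Real.log n)|
      ≤ |T 2| + |T n - T 2| + |(M n - Real.log n) / Real.log n| := h3 ▸ abs_add_three _ _ _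
    _ ≤ _ := by linarith
end

section
/- There exists an admissible set of 105 integers contained in the interval [0, 600]. -/
/-- A finite set `H` of integers is admissible if for every prime `p` there is an integer `n`
such that `p` does not divide `∏_{h ∈ H} (n + h)`. -/
def IsAdmissible (H : Finset ℤ) : Prop :=
  ∀ p : ℕ, p.Prime → ∃ n : ℤ, ¬ (p : ℤ) ∣ ∏ h ∈ H, (n + h)

/-- `H` is admissible as soon as, for each prime `p ≤ #H`, some translate of `H` avoids the
multiples of `p`: larger primes are handled by counting residue classes. -/
theorem isAdmissible_of_forall_le_card {H : Finset ℤ}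
    (hH : ∀ p : ℕ, p.Prime → p ≤ H.card → ∃ n : ℤ, ∀ h ∈ H, ¬ (p : ℤ) ∣ n + h) :
    IsAdmissible H := by
  intro p hp
  suffices ∃ n : ℤ, ∀ h ∈ H, ¬ (p : ℤ) ∣ n + h by
    obtain ⟨n, hn⟩ := this
    refine ⟨n, fun hdvd => ?_⟩
    obtain ⟨h, hh, hd⟩ := (Nat.prime_iff_prime_int.mp hp).exists_mem_finset_dvd hdvd
    exact hn h hh hd
  rcases le_or_gt p H.card with hle | hlt
  · exact hH p hp hle
  have : NeZero p := ⟨hp.ne_zero⟩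
  have hcard : (H.image fun h : ℤ => -(h : ZMod p)).card < Fintype.card (ZMod p) := by
    rw [ZMod.card]
    exact Finset.card_image_le.trans_lt hlt
  obtain ⟨x, hx⟩ := Finset.exists_mem_notMem_of_card_lt_card (t := Finset.univ) hcard
  obtain ⟨n, rfl⟩ := ZMod.intCast_surjective x
  refine ⟨n, fun h hh hd => hx.2 (Finset.mem_image.mpr ⟨h, hh, ?_⟩)⟩
  rw [← ZMod.intCast_zmod_eq_zero_iff_dvd, Int.cast_add] at hd
  exact (eq_neg_of_add_eq_zero_left hd).symm

/-- Engelsma's narrow admissible set of 105 integers, of diameter 600. -/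
def engelsmaTuple : Finset ℤ :=
  {0, 10, 12, 24, 28, 30, 34, 42, 48, 52, 54, 64, 70, 72, 78, 82, 90, 94, 100, 112, 114, 118,
    120, 124, 132, 138, 148, 154, 168, 174, 178, 180, 184, 190, 192, 202, 204, 208, 220, 222,
    232, 234, 250, 252, 258, 262, 264, 268, 280, 288, 294, 300, 310, 322, 324, 328, 330, 334,
    342, 352, 358, 360, 364, 372, 378, 384, 390, 394, 400, 402, 408, 412, 418, 420, 430, 432,
    442, 444, 450, 454, 462, 468, 472, 478, 484, 490, 492, 498, 504, 510, 528, 532, 534, 538,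
    544, 558, 562, 570, 574, 580, 582, 588, 594, 598, 600}

theorem card_engelsmaTuple : engelsmaTuple.card = 105 := by
  decide +kernel

theorem engelsmaTuple_mem_bounds : ∀ h ∈ engelsmaTuple, 0 ≤ h ∧ h ≤ 600 := by
  decide +kernel

theorem exists_translate_engelsmaTuple_not_dvd :
    ∀ p ∈ Finset.Icc 2 105, ∃ n ∈ Finset.range p,
      ∀ h ∈ engelsmaTuple, ¬ (p : ℤ) ∣ (n : ℤ) + h := by
  decide +kernel

/-- Engelsma: there is an admissible set of 105 integers contained in `[0, 600]`. -/
theorem exists_admissible_105_in_Icc_0_600 :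
    ∃ H : Finset ℤ, H.card = 105 ∧ (∀ h ∈ H, 0 ≤ h ∧ h ≤ 600) ∧ IsAdmissible H := by
  refine ⟨engelsmaTuple, card_engelsmaTuple, engelsmaTuple_mem_bounds,
    isAdmissible_of_forall_le_card fun p hp hle => ?_⟩
  rw [card_engelsmaTuple] at hle
  obtain ⟨n, -, hn⟩ :=
    exists_translate_engelsmaTuple_not_dvd p (Finset.mem_Icc.mpr ⟨hp.two_le, hle⟩)
  exact ⟨n, hn⟩
end
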